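/- Let L > 0 and M > 0, let q : [0,L] → ℝ be continuously differentiable with q'(x) < 0 for all x, q(0) = M, q(L) = 0, with inverse q⁻¹ : [0,M] → [0,L], and let k ≥ 1 be an integer. Set D = ∫₀^L q(x) dx, and for ξ ∈ (0,M): u(ξ) = (ξ/(πL)) ∫₀^{q⁻¹(ξ)} (q(x)² − ξ²)^{−1/2} dx, φ(ξ) = ξ ∫₀^{q⁻¹(ξ)} (q(x)² − ξ²)^{−1/2} dx / D, ν_k(ξ) = π ∫_{q⁻¹(ξ)}^L (ξ² − q(x)²)^{1/2} dx / (2D) + π(k−1)Lξ/(2D), σ_k(ξ) = 2ν_k(ξ)/φ(ξ), and u_k(ξ) = u(ξ)/k. Then for every ξ ∈ (0,M), ∫₀^M log((y+ξ)/|y−ξ|) · u_k(y) dy + σ_k(ξ) · u_k(ξ) = ξ. -/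

import Mathlib

open MeasureTheory Set

/-- The integrand of the Abel-type transform of the soliton interaction kernel. -/
noncomputable def abelLogKernel (ξ a y : ℝ) : ℝ :=
  Real.log ((y + ξ) / |y - ξ|) * (y * (1 / Real.sqrt (a ^ 2 - y ^ 2)))

lemma log_ratio_nonneg {y ξ : ℝ} (hy : 0 ≤ y) (hξ : 0 ≤ ξ) :
    0 ≤ Real.log ((y + ξ) / |y - ξ|) := by
  rcases eq_or_ne y ξ with rfl | h
  · simp
  · have hpos : 0 < |y - ξ| := abs_pos.mpr (sub_ne_zero.mpr h)
    apply Real.log_nonneg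
    rw [one_le_div hpos, abs_le]
    constructor <;> linarith

lemma abelLogKernel_nonneg {ξ a y : ℝ} (hy : 0 ≤ y) (hξ : 0 ≤ ξ) :
    0 ≤ abelLogKernel ξ a y := by
  have := log_ratio_nonneg hy hξ
  unfold abelLogKernel
  positivity

lemma abelLogKernel_eq_zero {ξ a y : ℝ} (ha : 0 ≤ a) (hay : a ≤ y) :
    abelLogKernel ξ a y = 0 := by
  have : Real.sqrt (a ^ 2 - y ^ 2) = 0 := Real.sqrt_eq_zero_of_nonpos (by nlinarith)
  simp [abelLogKernel, this]

lemma hasDerivAt_sqrt_sq_sub_sq {a y : ℝ} (h : 0 < a ^ 2 - y ^ 2) :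
    HasDerivAt (fun y : ℝ => Real.sqrt (a ^ 2 - y ^ 2)) (-y / Real.sqrt (a ^ 2 - y ^ 2)) y := by
  have h1 : HasDerivAt (fun y : ℝ => a ^ 2 - y ^ 2) (-(2 * y)) y := by
    simpa using ((hasDerivAt_id y).pow 2).const_sub (a ^ 2)
  convert h1.sqrt h.ne' using 1
  have := (Real.sqrt_pos.mpr h).ne'
  field_simp

lemma hasDerivAt_arcsin_div {a y : ℝ} (ha : 0 < a) (h : 0 < a ^ 2 - y ^ 2) :
    HasDerivAt (fun y : ℝ => Real.arcsin (y / a)) (1 / Real.sqrt (a ^ 2 - y ^ 2)) y := by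
  have hlt : |y / a| < 1 := by
    rw [← sq_lt_one_iff_abs_lt_one, div_pow, div_lt_one (by positivity)]
    linarith
  have hb := abs_lt.mp hlt
  have h2 := (Real.hasDerivAt_arcsin hb.1.ne' hb.2.ne).comp y ((hasDerivAt_id y).div_const a)
  refine h2.congr_deriv ?_
  have : 1 - (y / a) ^ 2 = (a ^ 2 - y ^ 2) / a ^ 2 := by field_simp
  rw [this, Real.sqrt_div' _ (by positivity), Real.sqrt_sq ha.le]
  have := (Real.sqrt_pos.mpr h).ne'
  field_simp

/-- A primitive of `abelLogKernel ξ a` when `0 < ξ < a`. -/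
noncomputable def abelLogPrimitiveInner (ξ a y : ℝ) : ℝ :=
  (Real.sqrt (a ^ 2 - y ^ 2) - Real.sqrt (a ^ 2 - ξ ^ 2)) * Real.log (y - ξ)
    - (Real.sqrt (a ^ 2 - y ^ 2) + Real.sqrt (a ^ 2 - ξ ^ 2)) * Real.log (y + ξ)
    + 2 * ξ * Real.arcsin (y / a)
    + 2 * Real.sqrt (a ^ 2 - ξ ^ 2)
      * Real.log (Real.sqrt (a ^ 2 - ξ ^ 2) * y + ξ * Real.sqrt (a ^ 2 - y ^ 2))

lemma hasDerivAt_abelLogPrimitiveInner {ξ a y : ℝ} (hξ : 0 < ξ) (hξa : ξ < a)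
    (hy : y ∈ Ioo 0 a) (hyξ : y ≠ ξ) :
    HasDerivAt (abelLogPrimitiveInner ξ a) (abelLogKernel ξ a y) y := by
  have ha : 0 < a := hξ.trans hξa
  have hy0 := hy.1
  have h0 : 0 < a ^ 2 - y ^ 2 := by nlinarith [hy.1, hy.2]
  have h1 : 0 < a ^ 2 - ξ ^ 2 := by nlinarith
  have hs := hasDerivAt_sqrt_sq_sub_sq h0
  have hA := hasDerivAt_arcsin_div ha h0
  unfold abelLogPrimitiveInner abelLogKernel
  have hs2 := Real.sq_sqrt h0.le
  have ht2 := Real.sq_sqrt h1.le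
  have hspos := Real.sqrt_pos.mpr h0
  have htpos := Real.sqrt_pos.mpr h1
  set t := Real.sqrt (a ^ 2 - ξ ^ 2)
  have hp : 0 < t * y + ξ * Real.sqrt (a ^ 2 - y ^ 2) := by positivity
  have hsub : y - ξ ≠ 0 := sub_ne_zero.mpr hyξ
  have hadd : y + ξ ≠ 0 := by positivity
  have d1 := (hs.sub_const t).mul (((hasDerivAt_id y).sub_const ξ).log hsub)
  have d2 := (hs.add_const t).mul (((hasDerivAt_id y).add_const ξ).log hadd)
  have d3 := ((((hasDerivAt_id y).const_mul t).add (hs.const_mul ξ)).log hp.ne').const_mul (2 * t)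
  refine (((d1.sub d2).add (hA.const_mul (2 * ξ))).add d3).congr_deriv ?_
  simp only [id_eq, Pi.add_apply]
  rw [Real.log_div hadd (abs_ne_zero.mpr hsub), Real.log_abs]
  set s := Real.sqrt (a ^ 2 - y ^ 2)
  have key : (s - t) * (1 / (y - ξ)) - (s + t) * (1 / (y + ξ))
      + 2 * ξ * (1 / s) + 2 * t * ((t * 1 + ξ * (-y / s)) / (t * y + ξ * s)) = 0 := by
    have e1 : (s - t) * (1 / (y - ξ)) - (s + t) * (1 / (y + ξ)) = -2 * a ^ 2 / (t * y + ξ * s) := by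
      field_simp
      linear_combination (-2 * y ^ 2) * ht2 + 2 * ξ ^ 2 * hs2
    have e2 : 2 * ξ * (1 / s) + 2 * t * ((t * 1 + ξ * (-y / s)) / (t * y + ξ * s))
        = 2 * a ^ 2 / (t * y + ξ * s) := by
      field_simp
      linear_combination s * ht2
    rw [add_assoc, e1, e2]
    ring
  linear_combination key

lemma continuousOn_abelLogPrimitiveInner {ξ a : ℝ} (hξ : 0 < ξ) (hξa : ξ < a) :
    ContinuousOn (abelLogPrimitiveInner ξ a) (Icc 0 a) := by
  have ha : 0 < a := hξ.trans hξa
  have h1 : 0 < a ^ 2 - ξ ^ 2 := by nlinarith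
  have htpos := Real.sqrt_pos.mpr h1
  have e : EqOn (abelLogPrimitiveInner ξ a) (fun y =>
      -((y + ξ) / (Real.sqrt (a ^ 2 - y ^ 2) + Real.sqrt (a ^ 2 - ξ ^ 2))
          * ((y - ξ) * Real.log (y - ξ)))
      - (Real.sqrt (a ^ 2 - y ^ 2) + Real.sqrt (a ^ 2 - ξ ^ 2)) * Real.log (y + ξ)
      + 2 * ξ * Real.arcsin (y / a)
      + 2 * Real.sqrt (a ^ 2 - ξ ^ 2)
        * Real.log (Real.sqrt (a ^ 2 - ξ ^ 2) * y + ξ * Real.sqrt (a ^ 2 - y ^ 2))) (Icc 0 a) := by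
    intro y hy
    have h0 : 0 ≤ a ^ 2 - y ^ 2 := by nlinarith [hy.1, hy.2]
    have : Real.sqrt (a ^ 2 - y ^ 2) - Real.sqrt (a ^ 2 - ξ ^ 2)
        = -((y + ξ) / (Real.sqrt (a ^ 2 - y ^ 2) + Real.sqrt (a ^ 2 - ξ ^ 2)) * (y - ξ)) := by
      have := Real.sqrt_nonneg (a ^ 2 - y ^ 2)
      field_simp
      linear_combination Real.sq_sqrt h0 - Real.sq_sqrt h1.le
    simp only [abelLogPrimitiveInner]
    rw [this]
    ring
  refine ContinuousOn.congr ?_ e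
  have hml : Continuous fun y : ℝ => (y - ξ) * Real.log (y - ξ) :=
    Real.continuous_mul_log.comp (continuous_id.sub continuous_const)
  have harc : Continuous fun y : ℝ => Real.arcsin (y / a) :=
    Real.continuous_arcsin.comp (continuous_id.div_const a)
  have hsq : Continuous fun y : ℝ => Real.sqrt (a ^ 2 - y ^ 2) := by fun_prop
  have hl1 : ContinuousOn (fun y : ℝ => Real.log (y + ξ)) (Icc 0 a) :=
    ContinuousOn.log (by fun_prop) fun y hy => by linarith [hy.1]
  have hl2 : ContinuousOn (fun y : ℝ => Real.log
      (Real.sqrt (a ^ 2 - ξ ^ 2) * y + ξ * Real.sqrt (a ^ 2 - y ^ 2))) (Icc 0 a) := by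
    refine ContinuousOn.log (by fun_prop) fun y hy => ?_
    rcases hy.1.eq_or_lt with rfl | hy0
    · have : 0 < Real.sqrt (a ^ 2 - 0 ^ 2) := Real.sqrt_pos.mpr (by nlinarith)
      positivity
    · positivity
  have hq : ContinuousOn (fun y : ℝ =>
      (y + ξ) / (Real.sqrt (a ^ 2 - y ^ 2) + Real.sqrt (a ^ 2 - ξ ^ 2))) (Icc 0 a) :=
    ContinuousOn.div (by fun_prop) (by fun_prop) fun y _ => by positivity
  exact ((((hq.mul hml.continuousOn).neg).sub
    ((hsq.continuousOn.add continuousOn_const).mul hl1)).add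
    (harc.continuousOn.const_smul (2 * ξ))).add (continuousOn_const.mul hl2)

/-- Fundamental theorem of calculus for a nonnegative integrand. -/
lemma intervalIntegrable_and_integral_of_hasDerivAt_of_nonneg {f g : ℝ → ℝ} {a b : ℝ}
    (hab : a ≤ b) (hc : ContinuousOn f (Icc a b)) (hd : ∀ x ∈ Ioo a b, HasDerivAt f (g x) x)
    (hn : ∀ x ∈ Ioo a b, 0 ≤ g x) :
    IntervalIntegrable g volume a b ∧ ∫ x in a..b, g x = f b - f a := by
  have hi : IntervalIntegrable g volume a b := by
    rw [intervalIntegrable_iff_integrableOn_Ioc_of_le hab]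
    exact intervalIntegral.integrableOn_deriv_of_nonneg hc hd hn
  exact ⟨hi, intervalIntegral.integral_eq_sub_of_hasDerivAt_of_le hab hc hd hi⟩

lemma integral_abelLogKernel_inner {ξ a : ℝ} (hξ : 0 < ξ) (hξa : ξ < a) :
    IntervalIntegrable (abelLogKernel ξ a) volume 0 a ∧
      ∫ y in (0 : ℝ)..a, abelLogKernel ξ a y = Real.pi * ξ := by
  have ha : 0 < a := hξ.trans hξa
  have hc := continuousOn_abelLogPrimitiveInner hξ hξa
  have hl := intervalIntegrable_and_integral_of_hasDerivAt_of_nonneg hξ.le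
    (hc.mono (Icc_subset_Icc_right hξa.le))
    (fun y hy => hasDerivAt_abelLogPrimitiveInner hξ hξa ⟨hy.1, hy.2.trans hξa⟩ hy.2.ne)
    (fun y hy => abelLogKernel_nonneg hy.1.le hξ.le)
  have hr := intervalIntegrable_and_integral_of_hasDerivAt_of_nonneg hξa.le
    (hc.mono (Icc_subset_Icc_left hξ.le))
    (fun y hy => hasDerivAt_abelLogPrimitiveInner hξ hξa ⟨hξ.trans hy.1, hy.2⟩ hy.1.ne')
    (fun y hy => abelLogKernel_nonneg (hξ.trans hy.1).le hξ.le)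
  refine ⟨hl.1.trans hr.1, ?_⟩
  rw [← intervalIntegral.integral_add_adjacent_intervals hl.1 hr.1, hl.2, hr.2]
  have h1 : 0 < a ^ 2 - ξ ^ 2 := by nlinarith
  have htpos := Real.sqrt_pos.mpr h1
  have hlog : 2 * Real.log (Real.sqrt (a ^ 2 - ξ ^ 2)) = Real.log (a - ξ) + Real.log (a + ξ) := by
    rw [Real.log_sqrt h1.le, ← Real.log_mul (by linarith) (by linarith)]
    ring_nf
  simp only [abelLogPrimitiveInner]
  have e1 : Real.sqrt (a ^ 2 - (0 : ℝ) ^ 2) = a := by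
    rw [zero_pow two_ne_zero, sub_zero, Real.sqrt_sq ha.le]
  rw [e1, sub_self (a ^ 2), Real.sqrt_zero, div_self ha.ne', Real.arcsin_one, zero_div, Real.arcsin_zero,
    mul_zero, mul_zero, zero_add, add_zero, zero_add, zero_sub, Real.log_neg_eq_log, mul_zero,
    add_zero, Real.log_mul htpos.ne' ha.ne', Real.log_mul hξ.ne' ha.ne']
  linear_combination Real.sqrt (a ^ 2 - ξ ^ 2) * hlog

/-- A primitive of `abelLogKernel ξ a` when `0 < a < ξ`. -/
noncomputable def abelLogPrimitiveOuter (ξ a y : ℝ) : ℝ :=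
  Real.sqrt (a ^ 2 - y ^ 2) * (Real.log (ξ - y) - Real.log (y + ξ))
    + 2 * ξ * Real.arcsin (y / a)
    - 2 * Real.sqrt (ξ ^ 2 - a ^ 2)
      * Real.arcsin (Real.sqrt (ξ ^ 2 - a ^ 2) * y / (a * Real.sqrt (ξ ^ 2 - y ^ 2)))

lemma hasDerivAt_abelLogPrimitiveOuter {ξ a y : ℝ} (ha : 0 < a) (haξ : a < ξ)
    (hy : y ∈ Ioo 0 a) :
    HasDerivAt (abelLogPrimitiveOuter ξ a) (abelLogKernel ξ a y) y := by
  have hξ : 0 < ξ := ha.trans haξ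
  have hy0 := hy.1
  have hyξ : y < ξ := hy.2.trans haξ
  have h0 : 0 < a ^ 2 - y ^ 2 := by nlinarith [hy.1, hy.2]
  have h1 : 0 < ξ ^ 2 - a ^ 2 := by nlinarith
  have h2 : 0 < ξ ^ 2 - y ^ 2 := by linarith
  have hs := hasDerivAt_sqrt_sq_sub_sq h0
  have hw := hasDerivAt_sqrt_sq_sub_sq h2
  have hA := hasDerivAt_arcsin_div ha h0
  unfold abelLogPrimitiveOuter abelLogKernel
  have hs2 := Real.sq_sqrt h0.le
  have hc2 := Real.sq_sqrt h1.le
  have hw2 := Real.sq_sqrt h2.le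
  have hspos := Real.sqrt_pos.mpr h0
  have hcpos := Real.sqrt_pos.mpr h1
  have hwpos := Real.sqrt_pos.mpr h2
  set c := Real.sqrt (ξ ^ 2 - a ^ 2)
  have hsub : ξ - y ≠ 0 := by linarith
  have hadd : y + ξ ≠ 0 := by positivity
  have d1 := hs.mul ((((hasDerivAt_id y).const_sub ξ).log hsub).sub
    (((hasDerivAt_id y).add_const ξ).log hadd))
  have hf := ((hasDerivAt_id y).const_mul c).div (hw.const_mul a) (by positivity)
  have hone : 1 - (c * y / (a * Real.sqrt (ξ ^ 2 - y ^ 2))) ^ 2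
      = (ξ * Real.sqrt (a ^ 2 - y ^ 2) / (a * Real.sqrt (ξ ^ 2 - y ^ 2))) ^ 2 := by
    field_simp
    rw [hc2, hs2, hw2]
    ring
  have hlt : |c * y / (a * Real.sqrt (ξ ^ 2 - y ^ 2))| < 1 := by
    rw [← sq_lt_one_iff_abs_lt_one, ← sub_pos, hone]
    positivity
  have hb := abs_lt.mp hlt
  have d3 := ((Real.hasDerivAt_arcsin hb.1.ne' hb.2.ne).comp y hf).const_mul (2 * c)
  refine ((d1.add (hA.const_mul (2 * ξ))).sub d3).congr_deriv ?_
  simp only [id_eq, Pi.sub_apply]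
  rw [hone, Real.sqrt_sq (by positivity), Real.log_div hadd (by rw [abs_ne_zero]; linarith),
    abs_of_neg (by linarith : y - ξ < 0), neg_sub]
  set s := Real.sqrt (a ^ 2 - y ^ 2)
  set w := Real.sqrt (ξ ^ 2 - y ^ 2)
  have e1 : 1 / (ξ * s / (a * w))
      * ((c * 1 * (a * w) - c * y * (a * (-y / w))) / (a * w) ^ 2) = c * ξ / (w ^ 2 * s) := by
    field_simp
    linear_combination hw2
  have e2 : s * (-1 / (ξ - y) - 1 / (y + ξ)) = -2 * ξ * s / w ^ 2 := by
    rw [hw2, show ξ ^ 2 - y ^ 2 = (ξ - y) * (y + ξ) by ring]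
    field_simp
    ring
  have e3 : -2 * ξ * s / w ^ 2 + 2 * ξ * (1 / s) - 2 * c * (c * ξ / (w ^ 2 * s)) = 0 := by
    field_simp
    linear_combination 2 * ξ * (hw2 - hs2 - hc2)
  rw [e1]
  linear_combination e2 + e3

lemma integral_abelLogKernel_outer {ξ a : ℝ} (ha : 0 < a) (haξ : a < ξ) :
    IntervalIntegrable (abelLogKernel ξ a) volume 0 a ∧
      ∫ y in (0 : ℝ)..a, abelLogKernel ξ a y
        = Real.pi * ξ - Real.pi * Real.sqrt (ξ ^ 2 - a ^ 2) := by
  have hξ : 0 < ξ := ha.trans haξ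
  have h1 : 0 < ξ ^ 2 - a ^ 2 := by nlinarith
  have hcpos := Real.sqrt_pos.mpr h1
  have hc : ContinuousOn (abelLogPrimitiveOuter ξ a) (Icc 0 a) := by
    have hsq : Continuous fun y : ℝ => Real.sqrt (a ^ 2 - y ^ 2) := by fun_prop
    have harc : Continuous fun y : ℝ => Real.arcsin (y / a) :=
      Real.continuous_arcsin.comp (continuous_id.div_const a)
    have hl1 : ContinuousOn (fun y : ℝ => Real.log (ξ - y)) (Icc 0 a) :=
      ContinuousOn.log (by fun_prop) fun y hy => by linarith [hy.2]
    have hl2 : ContinuousOn (fun y : ℝ => Real.log (y + ξ)) (Icc 0 a) :=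
      ContinuousOn.log (by fun_prop) fun y hy => by linarith [hy.1]
    have hf : ContinuousOn (fun y : ℝ => Real.sqrt (ξ ^ 2 - a ^ 2) * y
        / (a * Real.sqrt (ξ ^ 2 - y ^ 2))) (Icc 0 a) := by
      refine ContinuousOn.div (by fun_prop) (by fun_prop) fun y hy => ?_
      have : 0 < Real.sqrt (ξ ^ 2 - y ^ 2) := Real.sqrt_pos.mpr (by nlinarith [hy.1, hy.2])
      positivity
    exact ((hsq.continuousOn.mul (hl1.sub hl2)).add
      (continuousOn_const.mul harc.continuousOn)).sub
      (continuousOn_const.mul (Real.continuous_arcsin.comp_continuousOn hf))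
  have hl := intervalIntegrable_and_integral_of_hasDerivAt_of_nonneg ha.le hc
    (fun y hy => hasDerivAt_abelLogPrimitiveOuter ha haξ hy)
    (fun y hy => abelLogKernel_nonneg hy.1.le hξ.le)
  refine ⟨hl.1, ?_⟩
  rw [hl.2]
  simp only [abelLogPrimitiveOuter]
  have e : Real.sqrt (ξ ^ 2 - a ^ 2) * a / (a * Real.sqrt (ξ ^ 2 - a ^ 2)) = 1 := by
    field_simp
  rw [e, div_self ha.ne']
  simp
  ring

lemma integral_abelLogKernel {ξ a M : ℝ} (hξ : 0 < ξ) (ha : 0 < a) (hne : a ≠ ξ) (haM : a ≤ M) :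
    IntervalIntegrable (abelLogKernel ξ a) volume 0 M ∧
      ∫ y in (0 : ℝ)..M, abelLogKernel ξ a y
        = Real.pi * ξ - Real.pi * Real.sqrt (ξ ^ 2 - a ^ 2) := by
  have h1 : IntervalIntegrable (abelLogKernel ξ a) volume 0 a ∧
      ∫ y in (0 : ℝ)..a, abelLogKernel ξ a y
        = Real.pi * ξ - Real.pi * Real.sqrt (ξ ^ 2 - a ^ 2) := by
    rcases hne.lt_or_gt with h | h
    · exact integral_abelLogKernel_outer ha h
    · rw [Real.sqrt_eq_zero_of_nonpos (by nlinarith), mul_zero, sub_zero]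
      exact integral_abelLogKernel_inner hξ h
  have hz : EqOn (fun _ => (0 : ℝ)) (abelLogKernel ξ a) (uIcc a M) := fun y hy =>
    (abelLogKernel_eq_zero ha.le (by rw [uIcc_of_le haM] at hy; exact hy.1)).symm
  have h2 : IntervalIntegrable (abelLogKernel ξ a) volume a M :=
    (intervalIntegrable_const (c := (0 : ℝ))).congr (hz.mono uIoc_subset_uIcc)
  refine ⟨h1.1.trans h2, ?_⟩
  rw [← intervalIntegral.integral_add_adjacent_intervals h1.1 h2, h1.2,
    ← intervalIntegral.integral_congr hz]
  simp

lemma measurable_uncurry_abelLogKernel (ξ : ℝ) :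
    Measurable fun p : ℝ × ℝ => abelLogKernel ξ p.1 p.2 := by
  unfold abelLogKernel
  fun_prop

/-- Tonelli applied to the Abel kernel composed with a continuous profile. -/
lemma integral_integral_abelLogKernel {L M ξ : ℝ} {q : ℝ → ℝ} (hξ : 0 < ξ) (hM : 0 ≤ M)
    (hq : ContinuousOn q (Icc 0 L)) (hpos : ∀ᵐ x ∂volume.restrict (Ioc 0 L), 0 < q x)
    (hle : ∀ x ∈ Ioc 0 L, q x ≤ M) (hne : ∀ᵐ x ∂volume.restrict (Ioc 0 L), q x ≠ ξ) :
    ∫ y in Ioc 0 M, ∫ x in Ioc 0 L, abelLogKernel ξ (q x) y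
      = ∫ x in Ioc 0 L, (Real.pi * ξ - Real.pi * Real.sqrt (ξ ^ 2 - q x ^ 2)) := by
  have hle' : ∀ᵐ x ∂volume.restrict (Ioc 0 L), q x ≤ M := ae_restrict_of_forall_mem
    measurableSet_Ioc hle
  have hJ : ∀ᵐ x ∂volume.restrict (Ioc 0 L),
      IntegrableOn (abelLogKernel ξ (q x)) (Ioc 0 M) ∧ ∫ y in Ioc 0 M, abelLogKernel ξ (q x) y
        = Real.pi * ξ - Real.pi * Real.sqrt (ξ ^ 2 - q x ^ 2) := by
    filter_upwards [hpos, hle', hne] with x h1 h2 h3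
    have := integral_abelLogKernel hξ h1 h3 h2
    rwa [intervalIntegrable_iff_integrableOn_Ioc_of_le hM, intervalIntegral.integral_of_le hM]
      at this
  have hqm : AEMeasurable q (volume.restrict (Ioc 0 L)) :=
    (hq.mono Ioc_subset_Icc_self).aemeasurable measurableSet_Ioc
  have hmeas : AEStronglyMeasurable (fun p : ℝ × ℝ => abelLogKernel ξ (q p.1) p.2)
      ((volume.restrict (Ioc 0 L)).prod (volume.restrict (Ioc 0 M))) :=
    ((measurable_uncurry_abelLogKernel ξ).comp_aemeasurable
      (hqm.comp_fst.prodMk measurable_snd.aemeasurable)).aestronglyMeasurable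
  have hint : Integrable (fun p : ℝ × ℝ => abelLogKernel ξ (q p.1) p.2)
      ((volume.restrict (Ioc 0 L)).prod (volume.restrict (Ioc 0 M))) := by
    rw [integrable_prod_iff hmeas]
    refine ⟨hJ.mono fun x hx => hx.1, ?_⟩
    have hc : ContinuousOn
        (fun x => Real.pi * ξ - Real.pi * Real.sqrt (ξ ^ 2 - q x ^ 2)) (Icc 0 L) := by fun_prop
    refine (hc.integrableOn_Icc.mono_set Ioc_subset_Icc_self).congr ?_
    filter_upwards [hJ] with x hx
    rw [← hx.2]
    refine setIntegral_congr_fun measurableSet_Ioc fun y hy => ?_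
    exact (Real.norm_of_nonneg (abelLogKernel_nonneg hy.1.le hξ.le)).symm
  rw [← integral_integral_swap hint]
  exact integral_congr_ae (hJ.mono fun x hx => hx.2)

/-- `1 / √(q² - ξ²)` is integrable up to the turning point `b`, where `q b = ξ`. -/
lemma intervalIntegrable_one_div_sqrt_sq_sub_sq {L b ξ : ℝ} {q : ℝ → ℝ} (hξ : 0 < ξ)
    (hb : 0 < b) (hbL : b ≤ L) (hq : ContDiffOn ℝ 1 q (Icc 0 L))
    (hq' : ∀ x ∈ Icc (0:ℝ) L, derivWithin q (Icc 0 L) x < 0)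
    (hgt : ∀ x ∈ Ico 0 b, ξ < q x) (hqb : q b = ξ) :
    IntervalIntegrable (fun x => 1 / Real.sqrt (q x ^ 2 - ξ ^ 2)) volume 0 b := by
  have hsub : Icc 0 b ⊆ Icc 0 L := Icc_subset_Icc_right hbL
  have hqc : ContinuousOn q (Icc 0 b) := hq.continuousOn.mono hsub
  have hge : ∀ x ∈ Icc 0 b, ξ ≤ q x := fun x hx => by
    rcases hx.2.eq_or_lt with rfl | h
    · exact hqb.ge
    · exact (hgt x ⟨hx.1, h⟩).le
  have hdc : ContinuousOn (derivWithin q (Icc 0 L)) (Icc 0 b) :=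
    (hq.continuousOn_derivWithin (uniqueDiffOn_Icc (hb.trans_le hbL)) le_rfl).mono hsub
  have hprim := (intervalIntegrable_and_integral_of_hasDerivAt_of_nonneg
    (f := fun x => -Real.sqrt (q x - ξ))
    (g := fun x => -(derivWithin q (Icc 0 L) x / (2 * Real.sqrt (q x - ξ)))) hb.le
    (by fun_prop) (fun x hx => by
      have hnhds : Icc 0 L ∈ nhds x := Icc_mem_nhds hx.1 (hx.2.trans_le hbL)
      have hd : HasDerivAt q (derivWithin q (Icc 0 L) x) x := by
        rw [derivWithin_of_mem_nhds hnhds]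
        exact ((hq.contDiffAt hnhds).differentiableAt one_ne_zero).hasDerivAt
      have : q x - ξ ≠ 0 := (sub_pos.mpr (hgt x ⟨hx.1.le, hx.2⟩)).ne'
      exact ((hd.sub_const ξ).sqrt this).neg)
    (fun x hx => by
      have := (hq' x (hsub (Ioo_subset_Icc_self hx))).le
      rw [neg_nonneg]
      exact div_nonpos_of_nonpos_of_nonneg this (by positivity))).1
  have hfac : ContinuousOn
      (fun x => -2 / (derivWithin q (Icc 0 L) x * Real.sqrt (q x + ξ))) (uIcc 0 b) := by
    rw [uIcc_of_le hb.le]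
    refine ContinuousOn.div (by fun_prop) (by fun_prop) fun x hx => ?_
    have h1 := (hq' x (hsub hx)).ne
    have h2 : 0 < Real.sqrt (q x + ξ) := Real.sqrt_pos.mpr (by linarith [hge x hx])
    positivity
  refine (hprim.mul_continuousOn hfac).congr fun x hx => ?_
  rw [uIoc_of_le hb.le] at hx
  have hx' := Ioc_subset_Icc_self hx
  have h1 := (hq' x (hsub hx')).ne
  have h2 := hge x hx'
  have h3 : Real.sqrt (q x ^ 2 - ξ ^ 2) = Real.sqrt (q x - ξ) * Real.sqrt (q x + ξ) := by
    rw [← Real.sqrt_mul (by linarith)]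
    ring_nf
  rw [h3]
  field_simp

theorem stmt_17
    (L M : ℝ) (hL : 0 < L) (hM : 0 < M)
    (q qinv : ℝ → ℝ)
    (hq : ContDiffOn ℝ 1 q (Icc 0 L))
    (hq' : ∀ x ∈ Icc (0:ℝ) L, derivWithin q (Icc 0 L) x < 0)
    (hq0 : q 0 = M) (hqL : q L = 0)
    (hinv_left : ∀ x ∈ Icc (0:ℝ) L, qinv (q x) = x)
    (hinv_right : ∀ y ∈ Icc (0:ℝ) M, q (qinv y) = y)
    (k : ℕ) (hk : 1 ≤ k)
    (D : ℝ) (hD : D = ∫ x in (0:ℝ)..L, q x)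
    (u φ νk σk uk : ℝ → ℝ)
    (hu : ∀ ξ ∈ Ioo (0:ℝ) M,
      u ξ = (ξ / (Real.pi * L)) * ∫ x in (0:ℝ)..(qinv ξ), 1 / Real.sqrt (q x ^ 2 - ξ ^ 2))
    (hφ : ∀ ξ ∈ Ioo (0:ℝ) M,
      φ ξ = (ξ * ∫ x in (0:ℝ)..(qinv ξ), 1 / Real.sqrt (q x ^ 2 - ξ ^ 2)) / D)
    (hνk : ∀ ξ ∈ Ioo (0:ℝ) M,
      νk ξ = Real.pi * (∫ x in (qinv ξ)..L, Real.sqrt (ξ ^ 2 - q x ^ 2)) / (2 * D)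
        + Real.pi * ((k : ℝ) - 1) * L * ξ / (2 * D))
    (hσk : ∀ ξ ∈ Ioo (0:ℝ) M, σk ξ = 2 * νk ξ / φ ξ)
    (huk : ∀ ξ ∈ Ioo (0:ℝ) M, uk ξ = u ξ / (k : ℝ)) :
    ∀ ξ ∈ Ioo (0:ℝ) M,
      (∫ y in (0:ℝ)..M, Real.log ((y + ξ) / |y - ξ|) * uk y) + σk ξ * uk ξ = ξ := by
  intro ξ hξ
  have hqc : ContinuousOn q (Icc 0 L) := hq.continuousOn
  have hanti : StrictAntiOn q (Icc 0 L) := by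
    refine strictAntiOn_of_deriv_neg (convex_Icc 0 L) hqc fun x hx => ?_
    rw [interior_Icc] at hx
    rw [← derivWithin_of_mem_nhds (Icc_mem_nhds hx.1 hx.2)]
    exact hq' x (Ioo_subset_Icc_self hx)
  have h0mem : (0 : ℝ) ∈ Icc 0 L := left_mem_Icc.mpr hL.le
  have hLmem : L ∈ Icc 0 L := right_mem_Icc.mpr hL.le
  have hrange : ∀ x ∈ Icc 0 L, 0 ≤ q x ∧ q x ≤ M := fun x hx =>
    ⟨hqL ▸ hanti.antitoneOn hx hLmem hx.2, hq0 ▸ hanti.antitoneOn h0mem hx hx.1⟩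
  have hqinv : ∀ y ∈ Ioo 0 M, qinv y ∈ Ioo 0 L := fun y hy => by
    obtain ⟨x, hx, rfl⟩ := intermediate_value_Icc' hL.le hqc
      (show y ∈ Icc (q L) (q 0) by rw [hqL, hq0]; exact Ioo_subset_Icc_self hy)
    rw [hinv_left x hx]
    refine ⟨hx.1.lt_of_ne ?_, hx.2.lt_of_ne ?_⟩
    · rintro rfl
      exact hy.2.ne hq0
    · rintro rfl
      exact hy.1.ne' hqL
  have hK : ∀ y ∈ Ioo 0 M, ∫ x in (0 : ℝ)..(qinv y), 1 / Real.sqrt (q x ^ 2 - y ^ 2)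
      = ∫ x in Ioc 0 L, 1 / Real.sqrt (q x ^ 2 - y ^ 2) := fun y hy => by
    have hb := hqinv y hy
    rw [intervalIntegral.integral_of_le hb.1.le]
    refine (setIntegral_eq_of_subset_of_forall_sdiff_eq_zero measurableSet_Ioc
      (Ioc_subset_Ioc_right hb.2.le) fun x hx => ?_).symm
    have hxI := Ioc_subset_Icc_self hx.1
    have hbx : qinv y < x := not_le.mp fun h => hx.2 ⟨hx.1.1, h⟩
    have hlt : q x < y := by
      simpa only [hinv_right y (Ioo_subset_Icc_self hy)] using
        hanti (Ioo_subset_Icc_self hb) hxI hbx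
    rw [Real.sqrt_eq_zero_of_nonpos (by nlinarith [(hrange x hxI).1]), div_zero]
  have hS : ∫ x in (qinv ξ)..L, Real.sqrt (ξ ^ 2 - q x ^ 2)
      = ∫ x in Ioc 0 L, Real.sqrt (ξ ^ 2 - q x ^ 2) := by
    have hb := hqinv ξ hξ
    rw [intervalIntegral.integral_of_le hb.2.le]
    refine (setIntegral_eq_of_subset_of_forall_sdiff_eq_zero measurableSet_Ioc
      (Ioc_subset_Ioc_left hb.1.le) fun x hx => ?_).symm
    have hxI := Ioc_subset_Icc_self hx.1
    have hbx : x ≤ qinv ξ := not_lt.mp fun h => hx.2 ⟨h, hx.1.2⟩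
    have hle : ξ ≤ q x := by
      simpa only [hinv_right ξ (Ioo_subset_Icc_self hξ)] using
        hanti.antitoneOn hxI (Ioo_subset_Icc_self hb) hbx
    exact Real.sqrt_eq_zero_of_nonpos (by nlinarith [hξ.1])
  have hKpos : 0 < ∫ x in (0 : ℝ)..(qinv ξ), 1 / Real.sqrt (q x ^ 2 - ξ ^ 2) := by
    have hb := hqinv ξ hξ
    have hqb := hinv_right ξ (Ioo_subset_Icc_self hξ)
    have hgt : ∀ x ∈ Ico 0 (qinv ξ), ξ < q x := fun x hx => by
      simpa only [hqb] using
        hanti ⟨hx.1, hx.2.le.trans hb.2.le⟩ (Ioo_subset_Icc_self hb) hx.2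
    refine intervalIntegral.intervalIntegral_pos_of_pos_on
      (intervalIntegrable_one_div_sqrt_sq_sub_sq hξ.1 hb.1 hb.2.le hq hq' hgt hqb)
      (fun x hx => ?_) hb.1
    have := hgt x (Ioo_subset_Ico_self hx)
    exact one_div_pos.mpr (Real.sqrt_pos.mpr (by nlinarith [hξ.1]))
  have hDpos : 0 < D := by
    rw [hD]
    refine intervalIntegral.intervalIntegral_pos_of_pos_on
      (hqc.intervalIntegrable_of_Icc hL.le) (fun x hx => ?_) hL
    simpa only [hqL] using hanti (Ioo_subset_Icc_self hx) hLmem hx.2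
  have hkpos : (0 : ℝ) < k := by exact_mod_cast hk
  have hI : ∫ y in (0:ℝ)..M, Real.log ((y + ξ) / |y - ξ|) * uk y
      = 1 / (Real.pi * L * k)
        * ∫ y in Ioc 0 M, ∫ x in Ioc 0 L, abelLogKernel ξ (q x) y := by
    rw [intervalIntegral.integral_of_le hM.le, ← integral_const_mul, integral_Ioc_eq_integral_Ioo,
      integral_Ioc_eq_integral_Ioo]
    refine setIntegral_congr_fun measurableSet_Ioo fun y hy => ?_
    simp only [abelLogKernel]
    rw [huk y hy, hu y hy, hK y hy, integral_const_mul, integral_const_mul]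
    field_simp
  have hae : ∀ z : ℝ, ∀ᵐ x ∂volume.restrict (Ioc 0 L), x ≠ z := fun z =>
    ae_restrict_of_ae (Measure.ae_ne volume z)
  have hF := integral_integral_abelLogKernel (L := L) (M := M) hξ.1 hM.le hqc
    (by
      filter_upwards [hae L, ae_restrict_mem measurableSet_Ioc] with x hx hxI
      simpa only [hqL] using hanti (Ioc_subset_Icc_self hxI) hLmem (hxI.2.lt_of_ne hx))
    (fun x hx => (hrange x (Ioc_subset_Icc_self hx)).2)
    (by
      filter_upwards [hae (qinv ξ), ae_restrict_mem measurableSet_Ioc] with x hx hxI h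
      exact hx (h ▸ (hinv_left x (Ioc_subset_Icc_self hxI)).symm))
  have hSint : IntegrableOn (fun x => Real.pi * Real.sqrt (ξ ^ 2 - q x ^ 2)) (Ioc 0 L) := by
    have hc : ContinuousOn (fun x => Real.pi * Real.sqrt (ξ ^ 2 - q x ^ 2)) (Icc 0 L) := by
      fun_prop
    exact hc.integrableOn_Icc.mono_set Ioc_subset_Icc_self
  have hconst : ∫ _ in Ioc 0 L, Real.pi * ξ = L * (Real.pi * ξ) := by
    simp [hL.le]
  rw [integral_sub (integrable_const _) hSint, hconst, integral_const_mul, ← hS] at hF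
  rw [hI, hF, hσk ξ hξ, huk ξ hξ, hu ξ hξ, hνk ξ hξ, hφ ξ hξ]
  have hξ0 := hξ.1
  field_simp
  ring
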